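/- Fix 0 ≤ C_w ≤ C_t ≤ C_n and P̄_t ≥ 0, let V(D, A) be the hourly economic dispatch value function, and let R₁, R₂, R₃ be the three regimes. Let (D_k, A_k), k = 1, …, K, be hourly data and let P be a partition of {1, …, K} each of whose clusters maps into a single regime. Then every refinement P′ of P (every partition each of whose clusters is contained in a cluster of P) also has each cluster contained in a single regime, and hence the weighted-centroid aggregated cost under P′ also equals the full hourly cost: ∑_{k=1}^K V(D_k, A_k) = ∑_{G ∈ P′} |G| · V((1/|G|) ∑_{k∈G} (D_k, A_k)). -/

import Mathlib

/-- The hourly economic dispatch value function `V(D, A)`. -/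
noncomputable def dispatchValue (Cw Ct Cn Pt D A : ℝ) : ℝ :=
  sInf {c : ℝ | ∃ pw pt n : ℝ, pw + pt + n = D ∧ 0 ≤ pw ∧ pw ≤ A ∧ 0 ≤ pt ∧ pt ≤ Pt ∧
    0 ≤ n ∧ c = Cw * pw + Ct * pt + Cn * n}

/-- Regime 1 (wind marginal): `0 ≤ D ≤ A`. -/
def regime1 (Pt : ℝ) : Set (ℝ × ℝ) := {p : ℝ × ℝ | 0 ≤ p.1 ∧ p.1 ≤ p.2}

/-- Regime 2 (thermal marginal): `0 ≤ A ≤ D ≤ A + P̄t`. -/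
def regime2 (Pt : ℝ) : Set (ℝ × ℝ) :=
  {p : ℝ × ℝ | 0 ≤ p.2 ∧ p.2 ≤ p.1 ∧ p.1 ≤ p.2 + Pt}

/-- Regime 3 (non-supplied power marginal): `A ≥ 0`, `D ≥ A + P̄t`. -/
def regime3 (Pt : ℝ) : Set (ℝ × ℝ) := {p : ℝ × ℝ | 0 ≤ p.2 ∧ p.2 + Pt ≤ p.1}

theorem dispatchValue_eq_of_feasible_of_le {Cw Ct Cn Pt D A v : ℝ} (pw pt n : ℝ)
    (hsum : pw + pt + n = D) (hpw : 0 ≤ pw) (hpwA : pw ≤ A) (hpt : 0 ≤ pt) (hptP : pt ≤ Pt)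
    (hn : 0 ≤ n) (hv : v = Cw * pw + Ct * pt + Cn * n)
    (hle : ∀ pw pt n : ℝ, pw + pt + n = D → pw ≤ A → 0 ≤ pt → pt ≤ Pt → 0 ≤ n →
      v ≤ Cw * pw + Ct * pt + Cn * n) :
    dispatchValue Cw Ct Cn Pt D A = v := by
  refine IsLeast.csInf_eq ⟨⟨pw, pt, n, hsum, hpw, hpwA, hpt, hptP, hn, hv⟩, ?_⟩
  rintro c ⟨pw, pt, n, hsum, -, hpwA, hpt, hptP, hn, rfl⟩
  exact hle pw pt n hsum hpwA hpt hptP hn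

theorem dispatchValue_of_mem_regime1 {Cw Ct Cn Pt D A : ℝ} (hCwt : Cw ≤ Ct) (hCtn : Ct ≤ Cn)
    (hPt : 0 ≤ Pt) (h : (D, A) ∈ regime1 Pt) :
    dispatchValue Cw Ct Cn Pt D A = Cw * D + 0 * A + 0 := by
  obtain ⟨h0, h1⟩ : 0 ≤ D ∧ D ≤ A := h
  refine dispatchValue_eq_of_feasible_of_le D 0 0 (by ring) h0 h1 le_rfl hPt le_rfl (by ring) ?_
  rintro pw pt n rfl - hpt - hn
  linarith [mul_nonneg (sub_nonneg.2 hCwt) hpt, mul_nonneg (sub_nonneg.2 (hCwt.trans hCtn)) hn]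

theorem dispatchValue_of_mem_regime2 {Cw Ct Cn Pt D A : ℝ} (hCwt : Cw ≤ Ct) (hCtn : Ct ≤ Cn)
    (h : (D, A) ∈ regime2 Pt) :
    dispatchValue Cw Ct Cn Pt D A = Ct * D + (Cw - Ct) * A + 0 := by
  obtain ⟨h0, h1, h2⟩ : 0 ≤ A ∧ A ≤ D ∧ D ≤ A + Pt := h
  refine dispatchValue_eq_of_feasible_of_le A (D - A) 0 (by ring) h0 le_rfl (by linarith)
    (by linarith) le_rfl (by ring) ?_
  rintro pw pt n rfl hpw - - hn
  linarith [mul_nonneg (sub_nonneg.2 hCwt) (sub_nonneg.2 hpw),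
    mul_nonneg (sub_nonneg.2 hCtn) hn]

theorem dispatchValue_of_mem_regime3 {Cw Ct Cn Pt D A : ℝ} (hCwt : Cw ≤ Ct) (hCtn : Ct ≤ Cn)
    (hPt : 0 ≤ Pt) (h : (D, A) ∈ regime3 Pt) :
    dispatchValue Cw Ct Cn Pt D A = Cn * D + (Cw - Cn) * A + (Ct - Cn) * Pt := by
  obtain ⟨h0, h1⟩ : 0 ≤ A ∧ A + Pt ≤ D := h
  refine dispatchValue_eq_of_feasible_of_le A Pt (D - A - Pt) (by ring) h0 le_rfl hPt le_rfl
    (by linarith) (by ring) ?_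
  rintro pw pt n rfl hpw - hpt -
  linarith [mul_nonneg (sub_nonneg.2 (hCwt.trans hCtn)) (sub_nonneg.2 hpw),
    mul_nonneg (sub_nonneg.2 hCtn) (sub_nonneg.2 hpt)]

theorem convex_regime1 (Pt : ℝ) : Convex ℝ (regime1 Pt) := by
  rintro ⟨x, y⟩ ⟨h0, h1⟩ ⟨x', y'⟩ ⟨h0', h1'⟩ a b ha hb -
  simp only [regime1, Set.mem_ofPred_eq, Prod.smul_mk, Prod.mk_add_mk, smul_eq_mul] at *
  exact ⟨by positivity, by gcongr⟩

theorem convex_regime2 (Pt : ℝ) : Convex ℝ (regime2 Pt) := by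
  rintro ⟨x, y⟩ ⟨h0, h1, h2⟩ ⟨x', y'⟩ ⟨h0', h1', h2'⟩ a b ha hb hab
  simp only [regime2, Set.mem_ofPred_eq, Prod.smul_mk, Prod.mk_add_mk, smul_eq_mul] at *
  refine ⟨by positivity, by gcongr, ?_⟩
  calc a * x + b * x' ≤ a * (y + Pt) + b * (y' + Pt) := by gcongr
    _ = a * y + b * y' + (a + b) * Pt := by ring
    _ = a * y + b * y' + Pt := by rw [hab, one_mul]

theorem convex_regime3 (Pt : ℝ) : Convex ℝ (regime3 Pt) := by
  rintro ⟨x, y⟩ ⟨h0, h1⟩ ⟨x', y'⟩ ⟨h0', h1'⟩ a b ha hb hab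
  simp only [regime3, Set.mem_ofPred_eq, Prod.smul_mk, Prod.mk_add_mk, smul_eq_mul] at *
  refine ⟨by positivity, ?_⟩
  calc a * y + b * y' + Pt = a * y + b * y' + (a + b) * Pt := by rw [hab, one_mul]
    _ = a * (y + Pt) + b * (y' + Pt) := by ring
    _ ≤ a * x + b * x' := by gcongr

/-- A function that is affine on a convex set is aggregated exactly at centroids of points of
that set. -/
theorem sum_eq_card_mul_centroid_of_affine_on {ι : Type*} {V : ℝ → ℝ → ℝ} {S : Set (ℝ × ℝ)}
    (hS : Convex ℝ S) {a b c : ℝ} (hV : ∀ x y, (x, y) ∈ S → V x y = a * x + b * y + c)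
    {G : Finset ι} (hG : G.Nonempty) {D A : ι → ℝ} (hmem : ∀ k ∈ G, (D k, A k) ∈ S) :
    ∑ k ∈ G, V (D k) (A k) =
      (G.card : ℝ) * V ((∑ k ∈ G, D k) / G.card) ((∑ k ∈ G, A k) / G.card) := by
  have hcard : (G.card : ℝ) ≠ 0 := by exact_mod_cast hG.card_ne_zero
  have hcentroid : ((∑ k ∈ G, D k) / G.card, (∑ k ∈ G, A k) / G.card) ∈ S := by
    have h := hS.sum_mem (t := G) (w := fun _ => (G.card : ℝ)⁻¹)
      (fun _ _ => by positivity) (by simp [hcard]) hmem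
    rw [← Finset.smul_sum] at h
    convert h using 1
    ext <;> simp [Prod.fst_sum, Prod.snd_sum, div_eq_inv_mul]
  rw [hV _ _ hcentroid, Finset.sum_congr rfl fun k hk => hV _ _ (hmem k hk)]
  simp only [Finset.sum_add_distrib, ← Finset.mul_sum, Finset.sum_const, nsmul_eq_mul]
  field_simp

/-- Every refinement of an exact (regime-respecting) partition is itself
regime-respecting, and therefore its weighted-centroid aggregated cost also equals
the full hourly cost. Here `P' ≤ P` is the refinement order on `Finpartition`:
every cluster of `P'` is contained in some cluster of `P`. -/
theorem refinement_of_basis_partition_exact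
    (Cw Ct Cn Pt : ℝ) (hCw : 0 ≤ Cw) (hCwt : Cw ≤ Ct) (hCtn : Ct ≤ Cn) (hPt : 0 ≤ Pt)
    (K : ℕ) (D A : Fin K → ℝ) (hD : ∀ k, 0 ≤ D k) (hA : ∀ k, 0 ≤ A k)
    (P P' : Finpartition (Finset.univ : Finset (Fin K)))
    (hP : ∀ G ∈ P.parts, (∀ k ∈ G, (D k, A k) ∈ regime1 Pt) ∨
                         (∀ k ∈ G, (D k, A k) ∈ regime2 Pt) ∨
                         (∀ k ∈ G, (D k, A k) ∈ regime3 Pt))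
    (href : P' ≤ P) :
    (∀ G ∈ P'.parts, (∀ k ∈ G, (D k, A k) ∈ regime1 Pt) ∨
                     (∀ k ∈ G, (D k, A k) ∈ regime2 Pt) ∨
                     (∀ k ∈ G, (D k, A k) ∈ regime3 Pt)) ∧
    ∑ k, dispatchValue Cw Ct Cn Pt (D k) (A k) =
      ∑ G ∈ P'.parts, (G.card : ℝ) *
        dispatchValue Cw Ct Cn Pt
          ((∑ k ∈ G, D k) / G.card) ((∑ k ∈ G, A k) / G.card) := by
  have hP' : ∀ G ∈ P'.parts, (∀ k ∈ G, (D k, A k) ∈ regime1 Pt) ∨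
      (∀ k ∈ G, (D k, A k) ∈ regime2 Pt) ∨ (∀ k ∈ G, (D k, A k) ∈ regime3 Pt) := by
    intro G hG
    obtain ⟨H, hH, hGH⟩ := href hG
    exact (hP H hH).imp (fun h k hk => h k (hGH hk))
      (Or.imp (fun h k hk => h k (hGH hk)) fun h k hk => h k (hGH hk))
  refine ⟨hP', ?_⟩
  have hsum := Finset.sum_biUnion (f := fun k => dispatchValue Cw Ct Cn Pt (D k) (A k))
    P'.disjoint
  rw [P'.biUnion_parts] at hsum
  rw [hsum]
  refine Finset.sum_congr rfl fun G hG => ?_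
  have hne := P'.nonempty_of_mem_parts hG
  rcases hP' G hG with h | h | h
  · exact sum_eq_card_mul_centroid_of_affine_on (convex_regime1 Pt)
      (fun _ _ => dispatchValue_of_mem_regime1 hCwt hCtn hPt) hne h
  · exact sum_eq_card_mul_centroid_of_affine_on (convex_regime2 Pt)
      (fun _ _ => dispatchValue_of_mem_regime2 hCwt hCtn) hne h
  · exact sum_eq_card_mul_centroid_of_affine_on (convex_regime3 Pt)
      (fun _ _ => dispatchValue_of_mem_regime3 hCwt hCtn hPt) hne h
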